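/- Let A be a finite-dimensional algebra over a field k, and let T and U be bounded complexes of finitely generated projective right A-modules such that Hom_{D^b(mod A)}(T, U[n]) = 0 for every integer n ≠ 0. Then dim_k Hom_{D^b(mod A)}(T, U) = Σ_{ℓ,m} (−1)^{ℓ+m} dim_k Hom_A(T^ℓ, U^m), where the sum ranges over all pairs of integers (ℓ, m) and V^n denotes the n-th term of a complex V. -/

import Mathlib

open CategoryTheory

open CochainComplex.HomComplex in
lemma aux_Qmap_zero {C : Type*} [Category C] [Abelian C] [HasDerivedCategory C]
    (K L : CochainComplex C ℤ) [K.IsKProjective] (f : K ⟶ L) :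
    DerivedCategory.Q.map f = 0 ↔ Nonempty (Homotopy f 0) := by
  rw [← HomotopyCategory.quotient_map_eq_zero_iff]
  have hinj := (CochainComplex.IsKProjective.Qh_map_bijective K
    ((HomotopyCategory.quotient _ _).obj L)).injective
  constructor
  · intro h
    apply hinj
    rw [Functor.map_zero]
    rw [← cancel_mono ((DerivedCategory.quotientCompQhIso C).hom.app L)]
    erw [DerivedCategory.quotientCompQhIso_hom_naturality]
    rw [h, Limits.comp_zero, Limits.zero_comp]
  · intro h
    rw [← cancel_mono ((DerivedCategory.quotientCompQhIso C).inv.app L),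
      DerivedCategory.quotientCompQhIso_inv_naturality, h, Functor.map_zero]
    erw [Limits.comp_zero, Limits.zero_comp]

lemma aux_Qmap_surj {C : Type*} [Category C] [Abelian C] [HasDerivedCategory C]
    (K L : CochainComplex C ℤ) [K.IsKProjective]
    (g : DerivedCategory.Q.obj K ⟶ DerivedCategory.Q.obj L) :
    ∃ f : K ⟶ L, DerivedCategory.Q.map f = g := by
  obtain ⟨g', hg'⟩ := (CochainComplex.IsKProjective.Qh_map_bijective K
    ((HomotopyCategory.quotient _ _).obj L)).surjective
    ((DerivedCategory.quotientCompQhIso C).hom.app K ≫ g ≫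
      (DerivedCategory.quotientCompQhIso C).inv.app L)
  obtain ⟨f, rfl⟩ := (HomotopyCategory.quotient _ _).map_surjective g'
  refine ⟨f, ?_⟩
  rw [← cancel_epi ((DerivedCategory.quotientCompQhIso C).hom.app K),
    ← DerivedCategory.quotientCompQhIso_hom_naturality, hg']
  simp

open CochainComplex.HomComplex in
lemma aux_van {C : Type*} [Category C] [Abelian C] [HasDerivedCategory C]
    (K L : CochainComplex C ℤ) [K.IsKProjective] (n : ℤ)
    (hv : ∀ f : (DerivedCategory.Q.obj K ⟶ (DerivedCategory.Q.obj L)⟦n⟧), f = 0)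
    (z : Cocycle K L n) : z ∈ coboundaries K L n := by
  rw [← CohomologyClass.toHom_mk_eq_zero_iff, CohomologyClass.toHom_mk,
    HomotopyCategory.quotient_map_eq_zero_iff, ← aux_Qmap_zero,
    ← cancel_mono ((DerivedCategory.Q.commShiftIso n).hom.app L), Limits.zero_comp]
  exact hv _

section
open CochainComplex.HomComplex
variable {k : Type*} [Field k] {C : Type*} [Category C] [Abelian C] [HasDerivedCategory C]
  [Linear k C] (K L : CochainComplex C ℤ) [K.IsKProjective]

lemma aux_ker_le_range (n : ℤ)
    (hv : ∀ f : (DerivedCategory.Q.obj K ⟶ (DerivedCategory.Q.obj L)⟦n⟧), f = 0) :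
    (δ_hom k K L n (n + 1)).ker = (δ_hom k K L (n - 1) n).range := by
  ext x
  constructor
  · intro hx
    have := aux_van K L n hv (Cocycle.mk x (n + 1) rfl hx)
    rw [mem_coboundaries_iff _ (n - 1) (by lia)] at this
    obtain ⟨β, hβ⟩ := this
    exact ⟨β, hβ⟩
  · rintro ⟨β, rfl⟩
    simp [δ_δ]

lemma aux_H0 [Module k (DerivedCategory.Q.obj K ⟶ DerivedCategory.Q.obj L)]
    (hs : ∀ (c : k) (f : DerivedCategory.Q.obj K ⟶ DerivedCategory.Q.obj L),
      c • f = DerivedCategory.Q.map (c • (𝟙 K)) ≫ f)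
    [FiniteDimensional k (Cochain K L 0)] :
    Module.finrank k (DerivedCategory.Q.obj K ⟶ DerivedCategory.Q.obj L) +
      Module.finrank k (δ_hom k K L (-1) 0).range = Module.finrank k (δ_hom k K L 0 1).ker := by
  let toCo : (δ_hom k K L 0 1).ker → Cocycle K L 0 := fun x => Cocycle.mk x.1 1 rfl x.2
  let φ : (δ_hom k K L 0 1).ker →ₗ[k] (DerivedCategory.Q.obj K ⟶ DerivedCategory.Q.obj L) :=
    { toFun := fun x => DerivedCategory.Q.map (Cocycle.homOf (toCo x))
      map_add' := fun x y => by
        rw [← Functor.map_add]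
        congr 1
      map_smul' := fun c x => by
        rw [RingHom.id_apply, hs, ← Functor.map_comp, Linear.smul_comp, Category.id_comp]
        congr 1 }
  have hφ : ∀ x, φ x = DerivedCategory.Q.map (Cocycle.homOf (toCo x)) := fun x => rfl
  have hsurj : φ.range = ⊤ := by
    rw [LinearMap.range_eq_top]
    intro g
    obtain ⟨f, rfl⟩ := aux_Qmap_surj K L g
    refine ⟨⟨Cochain.ofHom f, by simp⟩, ?_⟩
    rw [hφ]
    congr 1
    exact Cocycle.homOf_ofHom_eq_self f
  have hker : φ.ker.map (δ_hom k K L 0 1).ker.subtype = (δ_hom k K L (-1) 0).range := by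
    ext x
    constructor
    · rintro ⟨y, hy, rfl⟩
      have hy' : φ y = 0 := hy
      rw [hφ, aux_Qmap_zero] at hy'
      obtain ⟨w, hw⟩ := Cochain.equivHomotopy _ _ hy'.some
      refine ⟨w, ?_⟩
      rw [Cocycle.cochain_ofHom_homOf_eq_coe, Cochain.ofHom_zero, add_zero] at hw
      exact hw.symm
    · rintro ⟨w, rfl⟩
      refine ⟨⟨δ (-1) 0 w, by simp [δ_δ]⟩, ?_, rfl⟩
      show φ _ = 0
      rw [hφ, aux_Qmap_zero]
      refine ⟨(Cochain.equivHomotopy _ _).symm ⟨w, ?_⟩⟩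
      rw [Cocycle.cochain_ofHom_homOf_eq_coe, Cochain.ofHom_zero, add_zero]
      rfl
  have h1 := LinearMap.finrank_range_add_finrank_ker φ
  rw [hsurj, finrank_top] at h1
  rw [← h1, ← hker]
  congr 1
  exact Submodule.finrank_map_subtype_eq _ _

end

section
open CochainComplex.HomComplex
variable {k : Type*} [Field k] {C : Type*} [Category C] [Preadditive C]
  [Linear k C] (K L : CochainComplex C ℤ)

noncomputable def auxEquiv (s : Finset ℤ) (hs : ∀ n ∉ s, Limits.IsZero (K.X n)) (n : ℤ) :
    Cochain K L n ≃ₗ[k] (∀ p : s, K.X p.1 ⟶ L.X (p.1 + n)) where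
  toFun γ p := γ.v p.1 (p.1 + n) rfl
  map_add' _ _ := rfl
  map_smul' _ _ := rfl
  invFun f := Cochain.mk (fun p q h =>
    if hp : p ∈ s then f ⟨p, hp⟩ ≫ eqToHom (by rw [h]) else 0)
  left_inv γ := by
    ext p q h
    subst h
    by_cases hp : p ∈ s
    · simp [hp]
    · exact (hs p hp).eq_of_src _ _
  right_inv f := by
    ext p
    simp

end

lemma aux_euler (c z b : ℤ → ℤ) (h : ℤ) (M : ℕ)
    (h1 : ∀ n, c n = z n + b (n + 1)) (h2 : ∀ n, n ≠ 0 → z n = b n) (h3 : z 0 = h + b 0)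
    (hb : ∀ n, (M : ℤ) < |n| → b n = 0) :
    h = ∑ i ∈ Finset.range (2 * M + 2), (((-M - 1 + i : ℤ)).negOnePow : ℤ) * c (-M - 1 + i) := by
  have key : ∀ j : ℕ, ∑ i ∈ Finset.range j,
      (((-M - 1 + i : ℤ)).negOnePow : ℤ) * c (-M - 1 + i) =
      - ((-M - 1 + j : ℤ).negOnePow : ℤ) * b (-M - 1 + j) +
        if (0 : ℤ) < -M - 1 + j then h else 0 := by
    intro j
    induction j with
    | zero =>
      rw [hb _ (by rw [lt_abs]; right; push_cast; lia), if_neg (by push_cast; lia)]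
      simp
    | succ j ih =>
      rw [Finset.sum_range_succ, ih, h1]
      push_cast
      rw [← add_assoc, Int.negOnePow_succ]
      generalize (-M - 1 + j : ℤ) = t
      rcases lt_trichotomy t 0 with ht | rfl | ht
      · rw [h2 t ht.ne, if_neg (by lia), if_neg (by lia)]
        push_cast; ring
      · rw [h3]
        simp
        ring
      · rw [h2 t ht.ne', if_pos (by lia), if_pos (by lia)]
        push_cast; ring
  rw [key, hb _ (by rw [lt_abs]; left; push_cast; lia), if_pos (by push_cast; lia)]
  simp

lemma aux_finsum (D : ℤ → ℤ → ℤ) (N : ℕ) (h1 : ∀ l m, (N : ℤ) < |l| → D l m = 0)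
    (h2 : ∀ l m, (N : ℤ) < |m| → D l m = 0) (M : ℕ) (hM : 2 * N ≤ M) :
    ∑ᶠ (l : ℤ), ∑ᶠ (m : ℤ), ((l + m).negOnePow : ℤ) * D l m =
    ∑ i ∈ Finset.range (2 * M + 2), (((-M - 1 + i : ℤ)).negOnePow : ℤ) *
      ∑ l ∈ Finset.Icc (-N : ℤ) N, D l (l + (-M - 1 + i)) := by
  simp_rw [Finset.mul_sum]
  rw [Finset.sum_comm]
  rw [finsum_eq_sum_of_support_subset (s := Finset.Icc (-N : ℤ) N)]
  · refine Finset.sum_congr rfl fun l hl => ?_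
    rw [← finsum_comp_equiv (Equiv.addLeft l)]
    simp only [Equiv.coe_addLeft]
    rw [finsum_eq_sum_of_support_subset
      (s := (Finset.range (2 * M + 2)).image (fun i : ℕ => (-M - 1 + i : ℤ)))]
    · rw [Finset.sum_image (fun a _ b _ hab => by simpa using hab)]
      refine Finset.sum_congr rfl fun i _ => ?_
      congr 2
      rw [← add_assoc, Int.negOnePow_add, Int.negOnePow_add l l]
      simp
    · intro n hn
      rw [Function.mem_support] at hn
      have h3 : ¬ (N : ℤ) < |l + n| := fun h => hn (by rw [h2 _ _ h, mul_zero])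
      rw [Finset.mem_Icc] at hl
      rw [not_lt, abs_le] at h3
      simp only [Finset.coe_image, Set.mem_image, Finset.coe_range, Set.mem_Iio]
      exact ⟨(n + M + 1).toNat, by lia, by lia⟩
  · intro l hl
    rw [Function.mem_support] at hl
    by_contra hc
    apply hl
    have : (N : ℤ) < |l| := by
      rw [lt_abs]; simp at hc; lia
    simp [h1 l _ this]

lemma aux_fin {k : Type*} [Field k] {A : Type*} [Ring A] [Algebra k A]
    [FiniteDimensional k A] (M N : ModuleCat A) [Module.Finite A M] [Module.Finite A N] :
    FiniteDimensional k (M ⟶ N) := by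
  let := ModuleCat.moduleOfAlgebraModule (k := k) M
  let := ModuleCat.moduleOfAlgebraModule (k := k) N
  have := ModuleCat.isScalarTower_of_algebra_moduleCat (k := k) M
  have := ModuleCat.isScalarTower_of_algebra_moduleCat (k := k) N
  have : Module.Finite k M := Module.Finite.trans A M
  have : Module.Finite k N := Module.Finite.trans A N
  let f : (M ⟶ N) →ₗ[k] (M →ₗ[k] N) :=
    { toFun := fun g => g.hom.restrictScalars k
      map_add' := fun _ _ => rfl
      map_smul' := fun _ _ => rfl }
  refine FiniteDimensional.of_injective f fun a b hab => ?_
  ext x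
  exact LinearMap.congr_fun hab x

open CochainComplex.HomComplex in
lemma aux_main {k : Type*} [Field k] {A : Type*} [Ring A] [Algebra k A] [FiniteDimensional k A]
    [HasDerivedCategory (ModuleCat A)]
    (T U : CochainComplex (ModuleCat A) ℤ)
    (hTbdd : ∃ N : ℕ, ∀ n : ℤ, (N : ℤ) < |n| → Limits.IsZero (T.X n))
    (hUbdd : ∃ N : ℕ, ∀ n : ℤ, (N : ℤ) < |n| → Limits.IsZero (U.X n))
    (hTproj : ∀ n : ℤ, Projective (T.X n))
    (hTfg : ∀ n : ℤ, Module.Finite A (T.X n))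
    (hUfg : ∀ n : ℤ, Module.Finite A (U.X n))
    (hvan : ∀ n : ℤ, n ≠ 0 →
        ∀ f : (DerivedCategory.Q.obj T ⟶ (DerivedCategory.Q.obj U)⟦n⟧), f = 0)
    {inst : Module k (DerivedCategory.Q.obj T ⟶ DerivedCategory.Q.obj U)}
    (hs : ∀ (c : k) (f : DerivedCategory.Q.obj T ⟶ DerivedCategory.Q.obj U),
      c • f = DerivedCategory.Q.map (c • (𝟙 T)) ≫ f) :
    (Module.finrank k (DerivedCategory.Q.obj T ⟶ DerivedCategory.Q.obj U) : ℤ) =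
      ∑ᶠ (l : ℤ), ∑ᶠ (m : ℤ),
        ((l + m).negOnePow : ℤ) * (Module.finrank k (T.X l ⟶ U.X m) : ℤ) := by
  obtain ⟨N₁, hN₁⟩ := hTbdd
  obtain ⟨N₂, hN₂⟩ := hUbdd
  obtain ⟨N, hT, hU⟩ : ∃ N : ℕ, (∀ n : ℤ, (N : ℤ) < |n| → Limits.IsZero (T.X n)) ∧
      (∀ n : ℤ, (N : ℤ) < |n| → Limits.IsZero (U.X n)) :=
    ⟨N₁ + N₂, fun n hn => hN₁ n (by push_cast at hn; lia), fun n hn => hN₂ n (by push_cast at hn; lia)⟩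
  have hle : T.IsStrictlyLE N := by
    rw [CochainComplex.isStrictlyLE_iff]
    intro i hi
    exact hT i (lt_of_lt_of_le hi (le_abs_self i))
  have hKP : T.IsKProjective := CochainComplex.isKProjective_of_projective T N
  have hD1 : ∀ l m, (N : ℤ) < |l| → (Module.finrank k (T.X l ⟶ U.X m) : ℤ) = 0 := by
    intro l m h
    have : Subsingleton (T.X l ⟶ U.X m) := ⟨fun a b => (hT l h).eq_of_src a b⟩
    rw [Module.finrank_zero_of_subsingleton]; rfl
  have hD2 : ∀ l m, (N : ℤ) < |m| → (Module.finrank k (T.X l ⟶ U.X m) : ℤ) = 0 := by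
    intro l m h
    have : Subsingleton (T.X l ⟶ U.X m) := ⟨fun a b => (hU m h).eq_of_tgt a b⟩
    rw [Module.finrank_zero_of_subsingleton]; rfl
  have hfin : ∀ l m, FiniteDimensional k (T.X l ⟶ U.X m) := fun l m => aux_fin _ _
  have e : ∀ n, Nonempty (Cochain T U n ≃ₗ[k]
      (∀ p : Finset.Icc (-N : ℤ) N, T.X p.1 ⟶ U.X (p.1 + n))) := fun n =>
    ⟨auxEquiv T U (Finset.Icc (-N : ℤ) N) (fun l hl => hT l (by
      rw [lt_abs]; simp at hl; lia)) n⟩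
  have hfinC : ∀ n, FiniteDimensional k (Cochain T U n) := fun n =>
    (e n).some.symm.finiteDimensional
  have hc : ∀ n, (Module.finrank k (Cochain T U n) : ℤ) =
      ∑ l ∈ Finset.Icc (-N : ℤ) N, (Module.finrank k (T.X l ⟶ U.X (l + n)) : ℤ) := by
    intro n
    rw [(e n).some.finrank_eq, Module.finrank_pi_fintype, Nat.cast_sum]
    exact Finset.sum_coe_sort (Finset.Icc (-N : ℤ) N)
      (fun l => (Module.finrank k (T.X l ⟶ U.X (l + n)) : ℤ))
  rw [aux_finsum (fun l m => (Module.finrank k (T.X l ⟶ U.X m) : ℤ)) N hD1 hD2 (2 * N) le_rfl]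
  simp_rw [← hc]
  refine aux_euler (fun n => (Module.finrank k (Cochain T U n) : ℤ))
    (fun n => (Module.finrank k (δ_hom k T U n (n + 1)).ker : ℤ))
    (fun n => (Module.finrank k (δ_hom k T U (n - 1) n).range : ℤ)) _ (2 * N) ?_ ?_ ?_ ?_
  · intro n
    have h1 := LinearMap.finrank_range_add_finrank_ker (δ_hom k T U n (n + 1))
    have h2 : ∀ m, m = n → Module.finrank k (δ_hom k T U m (n + 1)).range =
      Module.finrank k (δ_hom k T U n (n + 1)).range := by rintro _ rfl; rfl
    have h3 := h2 (n + 1 - 1) (by lia)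
    rw [h3, ← h1]
    push_cast; ring
  · intro n hn
    rw [aux_ker_le_range T U n (hvan n hn)]
  · have := aux_H0 T U hs
    exact_mod_cast this.symm
  · intro n hn
    have h1 : (Module.finrank k (Cochain T U n) : ℤ) = 0 := by
      rw [hc]
      refine Finset.sum_eq_zero fun l hl => hD2 _ _ ?_
      rw [Finset.mem_Icc] at hl
      rw [lt_abs] at hn ⊢
      push_cast at hn
      lia
    have h2 := Submodule.finrank_le (δ_hom k T U (n - 1) n).range
    lia

theorem statement15
    (k : Type) [Field k] (A : Type) [Ring A] [Algebra k A] [FiniteDimensional k A]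
    (T U : CochainComplex (ModuleCat A) ℤ)
    (hTbdd : ∃ N : ℕ, ∀ n : ℤ, (N : ℤ) < |n| → Limits.IsZero (T.X n))
    (hUbdd : ∃ N : ℕ, ∀ n : ℤ, (N : ℤ) < |n| → Limits.IsZero (U.X n))
    (hTproj : ∀ n : ℤ, Projective (T.X n))
    (hTfg : ∀ n : ℤ, Module.Finite A (T.X n))
    (hUproj : ∀ n : ℤ, Projective (U.X n))
    (hUfg : ∀ n : ℤ, Module.Finite A (U.X n))
    (hvan : letI := HasDerivedCategory.standard (ModuleCat A)
      ∀ n : ℤ, n ≠ 0 →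
        ∀ f : (DerivedCategory.Q.obj T ⟶ (DerivedCategory.Q.obj U)⟦n⟧), f = 0) :
    letI := HasDerivedCategory.standard (ModuleCat A)
    letI : Module k (DerivedCategory.Q.obj T ⟶ DerivedCategory.Q.obj U) :=
      { smul := fun c f => DerivedCategory.Q.map (c • (𝟙 T)) ≫ f
        one_smul := fun f => by
          show DerivedCategory.Q.map ((1 : k) • (𝟙 T)) ≫ f = f
          rw [one_smul k (𝟙 T), CategoryTheory.Functor.map_id, Category.id_comp]
        mul_smul := fun x y f => by
          show DerivedCategory.Q.map ((x * y) • (𝟙 T)) ≫ f =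
            DerivedCategory.Q.map (x • (𝟙 T)) ≫ (DerivedCategory.Q.map (y • (𝟙 T)) ≫ f)
          rw [← Category.assoc, ← CategoryTheory.Functor.map_comp, Linear.smul_comp, Linear.comp_smul,
            Category.id_comp, smul_smul]
        smul_zero := fun c => by
          show DerivedCategory.Q.map (c • (𝟙 T)) ≫ (0 : _) = 0
          rw [Limits.comp_zero]
        smul_add := fun c f g => by
          show DerivedCategory.Q.map (c • (𝟙 T)) ≫ (f + g) = _ ≫ f + _ ≫ g
          rw [Preadditive.comp_add]
        add_smul := fun x y f => by
          show DerivedCategory.Q.map ((x + y) • (𝟙 T)) ≫ f =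
            DerivedCategory.Q.map (x • (𝟙 T)) ≫ f + DerivedCategory.Q.map (y • (𝟙 T)) ≫ f
          rw [add_smul, CategoryTheory.Functor.map_add, Preadditive.add_comp]
        zero_smul := fun f => by
          show DerivedCategory.Q.map ((0 : k) • (𝟙 T)) ≫ f = 0
          rw [zero_smul k (𝟙 T), CategoryTheory.Functor.map_zero, Limits.zero_comp] }
    (Module.finrank k (DerivedCategory.Q.obj T ⟶ DerivedCategory.Q.obj U) : ℤ) =
      ∑ᶠ (l : ℤ), ∑ᶠ (m : ℤ),
        ((l + m).negOnePow : ℤ) * (Module.finrank k (T.X l ⟶ U.X m) : ℤ) := by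
  let := HasDerivedCategory.standard (ModuleCat A)
  apply aux_main T U hTbdd hUbdd hTproj hTfg hUfg hvan
  exact fun _ _ => rfl
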